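/- Let ⪯ be a strongly artinian preorder on a monoid H and s an integer ≥ 2 such that, for every x ∈ H that is neither a ⪯-unit nor a ⪯-quark, there exist k with 2 ≤ k ≤ s and ⪯-non-units y₁, …, y_k ∈ H with x = y₁⋯y_k, yᵢ ⪯ x for each i, and hgt(y₁) + ⋯ + hgt(y_k) ≤ hgt(x) + k − 2. Then every ⪯-non-unit x ∈ H is a product of at most (s−1)·hgt(x) − (s−2) ⪯-quarks. -/

import Mathlib

/-- `u` is a `⪯`-unit of the monoid `H`: `u ⪯ 1` and `1 ⪯ u`. -/
def IsPreUnit {H : Type*} [Monoid H] (le : H → H → Prop) (u : H) : Prop :=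
  le u 1 ∧ le 1 u

/-- The strict relation associated with the preorder `le`: `x ≺ y`. -/
def PreLt {H : Type*} [Monoid H] (le : H → H → Prop) (x y : H) : Prop :=
  le x y ∧ ¬ le y x

/-- `a` is a `⪯`-quark: a `⪯`-non-unit with no `⪯`-non-unit strictly below it. -/
def IsPreQuark {H : Type*} [Monoid H] (le : H → H → Prop) (a : H) : Prop :=
  ¬ IsPreUnit le a ∧ ∀ b, ¬ IsPreUnit le b → ¬ PreLt le b a

/-- The `⪯`-height of `x`: the supremum in `ℕ∞` (with `sSup ∅ = 0`) of the set of
integers `n ≥ 1` for which there is a sequence `x₁, …, xₙ` of `⪯`-non-units with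
`x₁ = x` and `x_{k+1} ≺ x_k` for `1 ≤ k ≤ n-1`. -/
noncomputable def preHgt {H : Type*} [Monoid H] (le : H → H → Prop) (x : H) : ℕ∞ :=
  sSup ((fun n : ℕ => (n : ℕ∞)) ''
    {n : ℕ | 1 ≤ n ∧ ∃ f : ℕ → H, f 1 = x ∧
      (∀ i, 1 ≤ i → i ≤ n → ¬ IsPreUnit le (f i)) ∧
      (∀ i, 1 ≤ i → i < n → PreLt le (f (i + 1)) (f i))})

/-- A `⪯`-non-unit has height at least one. -/
theorem one_le_preHgt {H : Type*} [Monoid H] (le : H → H → Prop) {x : H}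
    (hx : ¬ IsPreUnit le x) : 1 ≤ preHgt le x := by
  refine le_sSup ⟨1, ⟨le_rfl, fun _ => x, rfl, fun _ _ _ => hx, fun i h₁ h₂ => ?_⟩, by simp⟩
  omega

/-- If `P`-factorizations of the entries of a list have lengths bounded by `c * h y - t`, then
concatenating them gives a `P`-factorization of the product, with the summed length bound. -/
theorem exists_factorization_list_prod {H : Type*} [Monoid H] {P : H → Prop} {h : H → ℕ}
    {c t : ℕ} (l : List H)
    (hl : ∀ y ∈ l, ∃ L : List H, (∀ a ∈ L, P a) ∧ L.prod = y ∧ L.length + t ≤ c * h y) :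
    ∃ L : List H, (∀ a ∈ L, P a) ∧ L.prod = l.prod ∧
      L.length + l.length * t ≤ c * (l.map h).sum := by
  induction l with
  | nil => exact ⟨[], by simp⟩
  | cons y l ih =>
    obtain ⟨L, hL, hprod, hlen⟩ := hl y List.mem_cons_self
    obtain ⟨M, hM, hprod', hlen'⟩ := ih fun z hz => hl z (List.mem_cons_of_mem y hz)
    refine ⟨L ++ M, ?_, by simp [hprod, hprod'], ?_⟩
    · intro a ha
      exact (List.mem_append.mp ha).elim (hL a) (hM a)
    · simp only [List.length_append, List.length_cons, List.map_cons, List.sum_cons]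
      nlinarith

/-- In a list whose entries have weight at least one, an entry's weight plus the number of
other entries is at most the total weight. -/
theorem add_length_le_sum_map_add_one {α : Type*} {h : α → ℕ} (l : List α)
    (hl : ∀ y ∈ l, 1 ≤ h y) {y : α} (hy : y ∈ l) :
    h y + l.length ≤ (l.map h).sum + 1 := by
  obtain ⟨l₁, l₂, rfl⟩ := List.append_of_mem hy
  have key : ∀ m : List α, (∀ z ∈ m, 1 ≤ h z) → m.length ≤ (m.map h).sum := fun m hm => by
    simpa using List.length_le_sum_of_one_le (m.map h) (by simpa using hm)
  have h₁ := key l₁ fun z hz => hl z (by simp [hz])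
  have h₂ := key l₂ fun z hz => hl z (by simp [hz])
  simp only [List.length_append, List.length_cons, List.map_append, List.map_cons,
    List.sum_append, List.sum_cons]
  omega

/-- Let `⪯` be a strongly artinian preorder on a monoid `H` and `s ≥ 2`
such that every element that is neither a `⪯`-unit nor a `⪯`-quark factors as a product
of `k` `⪯`-non-units (`2 ≤ k ≤ s`), each `⪯ x`, whose heights sum to at most
`hgt(x) + k - 2`. Then every `⪯`-non-unit `x` is a product of at most
`(s-1)·hgt(x) - (s-2)` `⪯`-quarks. -/
theorem abstract_factorization_into_quarks {H : Type*} [Monoid H]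
    (le : H → H → Prop)
    (hrefl : ∀ x, le x x) (htrans : ∀ x y z, le x y → le y z → le x z)
    (s : ℕ) (hs : 2 ≤ s)
    (hstrong : ∀ x : H, preHgt le x ≠ ⊤)
    (hfact : ∀ x : H, ¬ IsPreUnit le x → ¬ IsPreQuark le x →
      ∃ l : List H, 2 ≤ l.length ∧ l.length ≤ s ∧
        (∀ y ∈ l, ¬ IsPreUnit le y ∧ le y x) ∧ l.prod = x ∧
        (l.map (preHgt le)).sum ≤ preHgt le x + (l.length : ℕ∞) - 2)
    (x : H) (hx : ¬ IsPreUnit le x) :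
    ∃ l : List H, l ≠ [] ∧ (∀ a ∈ l, IsPreQuark le a) ∧ l.prod = x ∧
      (l.length : ℕ∞) ≤ ((s : ℕ∞) - 1) * preHgt le x - ((s : ℕ∞) - 2) := by
  obtain ⟨t, rfl⟩ := Nat.exists_eq_add_of_le' hs
  choose h hh using fun x => ENat.ne_top_iff_exists.mp (hstrong x)
  have hpos : ∀ y, ¬ IsPreUnit le y → 1 ≤ h y := fun y hy => by
    have := one_le_preHgt le hy
    rw [← hh] at this
    exact_mod_cast this
  have hsum : ∀ l : List H, (l.map (preHgt le)).sum = (((l.map h).sum : ℕ) : ℕ∞) := fun l => by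
    induction l with
    | nil => simp
    | cons y l ih => simp [ih, hh]
  have main : ∀ n x, h x = n → ¬ IsPreUnit le x → ∃ L : List H,
      (∀ a ∈ L, IsPreQuark le a) ∧ L.prod = x ∧ L.length + t ≤ (t + 1) * h x := by
    intro n
    induction n using Nat.strong_induction_on with
    | _ n ih =>
      rintro x rfl hx
      by_cases hq : IsPreQuark le x
      · refine ⟨[x], by simpa using hq, by simp, ?_⟩
        have := hpos x hx
        simp only [List.length_singleton]
        nlinarith
      · obtain ⟨l, h2, hls, hl, rfl, hle⟩ := hfact x hx hq
        rw [hsum, ← hh] at hle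
        have hle' : (l.map h).sum ≤ h l.prod + l.length - 2 := by exact_mod_cast hle
        obtain ⟨L, hL, hprod, hlen⟩ := exists_factorization_list_prod
          (P := IsPreQuark le) (h := h) (c := t + 1) (t := t) l fun y hy => by
            have := add_length_le_sum_map_add_one l (fun z hz => hpos z (hl z hz).1) hy
            exact ih (h y) (by omega) y rfl (hl y hy).1
        refine ⟨L, hL, hprod, ?_⟩
        have hle'' : (l.map h).sum + 2 ≤ h l.prod + l.length := by omega
        nlinarith [Nat.mul_le_mul_left (t + 1) hle'']
  obtain ⟨L, hL, hprod, hlen⟩ := main (h x) x rfl hx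
  refine ⟨L, ?_, hL, hprod, ?_⟩
  · rintro rfl
    exact hx (hprod ▸ ⟨hrefl 1, hrefl 1⟩)
  · rw [← hh]
    have : L.length ≤ (t + 2 - 1) * h x - (t + 2 - 2) := by
      rw [show t + 2 - 1 = t + 1 by omega]
      omega
    exact_mod_cast this
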